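/- The polygonal Hodge star of a constant 1-form on a planar polygon is exact: let p ≥ 3 and let v : ℤ/pℤ → ℝ² be the vertices of a closed planar p-gon with positive signed area A > 0, edge vectors e_i = v_{i+1} − v_i. For a constant vector u ∈ ℝ², let β be the discrete flat of u, i.e., β(j) = ⟨u, e_j⟩. Then for every i ∈ ℤ/pℤ: (⋆₁β)(e_i) := (1/A) ∑_{j ∈ ℤ/pℤ} ⟨e_i, e_j⟩ ∑_{a=1}^{⌊(p−1)/2⌋} (1/2 − a/p)(β(j−a) − β(j+a)) = ⟨J u, e_i⟩, where J(u_x, u_y) = (−u_y, u_x); that is, ⋆₁(u♭) equals the discrete flat of the rotated vector Ju. -/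

import Mathlib

open Finset in
theorem ZMod.sum_range_add_natCast {M : Type*} [AddCommMonoid M] {p : ℕ} [NeZero p]
    (w : ZMod p → M) (c : ZMod p) :
    ∑ n ∈ range p, w (c + n) = ∑ k, w k := by
  rw [← Equiv.sum_comp (Equiv.addLeft c) w]
  refine sum_bij' (fun n _ => (n : ZMod p)) (fun k _ => k.val) ?_ ?_ ?_ ?_ ?_
  · simp
  · intro k _
    exact mem_range.2 k.val_lt
  · intro n hn
    exact ZMod.val_cast_of_lt (mem_range.1 hn)
  · simp
  · simp

open Finset in
theorem ZMod.sum_range_sub_add_add {M : Type*} [AddCommMonoid M] {p : ℕ}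
    (w : ZMod p → M) (j : ZMod p) (m : ℕ) :
    ∑ a ∈ range m, (w (j - a) + w (j + 1 + a)) =
      ∑ n ∈ range (2 * m), w (j + 1 - m + n) := by
  induction m with
  | zero => simp
  | succ m ih =>
    rw [sum_range_succ, ih, show 2 * (m + 1) = 2 * m + 1 + 1 by ring, sum_range_succ,
      sum_range_succ']
    have h₀ : j + 1 - ((m + 1 : ℕ) : ZMod p) + ((0 : ℕ) : ZMod p) = j - m := by
      push_cast; ring
    have h₁ : j + 1 - ((m + 1 : ℕ) : ZMod p) + ((2 * m + 1 : ℕ) : ZMod p) = j + 1 + m := by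
      push_cast; ring
    have h₂ (n : ℕ) : j + 1 - ((m + 1 : ℕ) : ZMod p) + ((n + 1 : ℕ) : ZMod p) =
        j + 1 - m + n := by
      push_cast; ring
    simp only [h₀, h₁, h₂, add_assoc]

open Finset in
/-- Summation by parts for the Hodge star weights applied to a difference. -/
theorem ZMod.sum_hodge_weight_mul_sub {p : ℕ} (w : ZMod p → ℝ) (j : ZMod p) (m : ℕ) :
    ∑ a ∈ Icc 1 m, ((1 : ℝ) / 2 - (a : ℝ) / (p : ℝ)) *
        ((w (j - a + 1) - w (j - a)) - (w (j + a + 1) - w (j + a))) =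
      (w j + w (j + 1)) / 2 - (1 / 2 - (m : ℝ) / p) * (w (j - m) + w (j + 1 + m)) -
        1 / p * ∑ a ∈ range m, (w (j - a) + w (j + 1 + a)) := by
  induction m with
  | zero => simp; ring
  | succ m ih =>
    rw [sum_Icc_succ_top (by omega), ih, sum_range_succ]
    have h₀ : j - ((m + 1 : ℕ) : ZMod p) + 1 = j - m := by push_cast; ring
    have h₁ : j + ((m + 1 : ℕ) : ZMod p) + 1 = j + 1 + ((m + 1 : ℕ) : ZMod p) := by ring
    have h₂ : j + ((m + 1 : ℕ) : ZMod p) = j + 1 + m := by push_cast; ring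
    rw [h₀, h₁, h₂]
    push_cast
    ring

/-- The Hodge star weights turn the difference of `w` into the midpoint value of `w` minus
its mean. -/
theorem ZMod.sum_hodge_weight_eq_midpoint_sub_mean {p : ℕ} [NeZero p]
    (w : ZMod p → ℝ) (j : ZMod p) :
    ∑ a ∈ Finset.Icc 1 ((p - 1) / 2), ((1 : ℝ) / 2 - (a : ℝ) / (p : ℝ)) *
        ((w (j - a + 1) - w (j - a)) - (w (j + a + 1) - w (j + a))) =
      (w j + w (j + 1)) / 2 - 1 / p * ∑ k, w k := by
  rw [ZMod.sum_hodge_weight_mul_sub]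
  set m := (p - 1) / 2 with hm
  have hp : p ≠ 0 := NeZero.ne p
  have hp' : (p : ℝ) ≠ 0 := Nat.cast_ne_zero.2 hp
  have hsum := ZMod.sum_range_sub_add_add w j m
  obtain h | h : p = 2 * m + 1 ∨ p = 2 * (m + 1) := by omega
  · have hfull := ZMod.sum_range_add_natCast w (j + 1 - m)
    have hr : (p : ℝ) = 2 * m + 1 := by exact_mod_cast h
    have hz : (2 * m + 1 : ZMod p) = 0 := by
      have hc := congrArg (Nat.cast : ℕ → ZMod p) h
      rw [ZMod.natCast_self] at hc
      exact_mod_cast hc.symm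
    have h₁ : j + 1 - (m : ZMod p) + ((2 * m : ℕ) : ZMod p) = j + 1 + m := by push_cast; ring
    have h₂ : j - (m : ZMod p) = j + 1 + m := by linear_combination -hz
    rw [show Finset.range p = Finset.range (2 * m + 1) by rw [← h], Finset.sum_range_succ,
      h₁] at hfull
    rw [hsum, ← hfull, h₂]
    field_simp
    rw [hr]
    ring
  · have hfull := ZMod.sum_range_add_natCast w (j + 1 - ((m + 1 : ℕ) : ZMod p))
    have hr : (p : ℝ) = 2 * (m + 1) := by exact_mod_cast h
    rw [show Finset.range p = Finset.range (2 * (m + 1)) by rw [← h],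
      ← ZMod.sum_range_sub_add_add, Finset.sum_range_succ] at hfull
    rw [← hfull]
    field_simp
    rw [hr]
    ring


/-- The Euclidean inner product on ℝ². -/
def dot2 (u w : Fin 2 → ℝ) : ℝ := u 0 * w 0 + u 1 * w 1

/-- Counterclockwise rotation by 90 degrees: `J(u_x, u_y) = (−u_y, u_x)`. -/
def rot90 (u : Fin 2 → ℝ) : Fin 2 → ℝ := ![-u 1, u 0]

/-- The polygonal Hodge star of a constant 1-form on a planar polygon is exact:
for a closed planar `p`-gon with positive signed area `A`, edge vectors
`e_i = v_{i+1} − v_i`, and `β` the discrete flat of a constant vector `u`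
(`β(j) = ⟨u, e_j⟩`), for every `i`:
`(⋆₁β)(e_i) = (1/A) ∑_j ⟨e_i, e_j⟩ ∑_{a=1}^{⌊(p−1)/2⌋} (1/2 − a/p)(β(j−a) − β(j+a))
            = ⟨J u, e_i⟩`,
i.e. `⋆₁(u♭)` is the discrete flat of the rotated vector `J u`. -/
theorem polyHodgeStar1_constant_exact
    (p : ℕ) (hp : 3 ≤ p) [NeZero p]
    (v : ZMod p → Fin 2 → ℝ)
    (e : ZMod p → Fin 2 → ℝ) (he : ∀ i, e i = v (i + 1) - v i)
    (A : ℝ)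
    (hA : A = (1 : ℝ) / 2 * ∑ j : ZMod p, (v j 0 * v (j + 1) 1 - v j 1 * v (j + 1) 0))
    (hApos : 0 < A)
    (u : Fin 2 → ℝ)
    (β : ZMod p → ℝ) (hβ : ∀ j, β j = dot2 u (e j))
    (i : ZMod p) :
    (1 / A) * ∑ j : ZMod p, dot2 (e i) (e j) *
        ∑ a ∈ Finset.Icc 1 ((p - 1) / 2),
          ((1 : ℝ) / 2 - (a : ℝ) / (p : ℝ)) *
            (β (j - (a : ZMod p)) - β (j + (a : ZMod p))) =
      dot2 (rot90 u) (e i) := by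
  have hshift (f : ZMod p → ℝ) : ∑ j, f (j + 1) = ∑ j, f j :=
    Equiv.sum_comp (Equiv.addRight 1) f
  set w : ZMod p → ℝ := fun k => dot2 u (v k) with hw
  have hβw (k : ZMod p) : β k = w (k + 1) - w k := by
    simp only [hβ, he, hw, dot2, Pi.sub_apply]
    ring
  simp only [hβw, ZMod.sum_hodge_weight_eq_midpoint_sub_mean]
  generalize 1 / (p : ℝ) * ∑ k, w k = μ
  rw [one_div, inv_mul_eq_iff_eq_mul₀ hApos.ne', hA, mul_assoc, Finset.sum_mul,
    Finset.mul_sum, ← sub_eq_zero, ← Finset.sum_sub_distrib]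
  set F : ZMod p → ℝ := fun k =>
    e i 0 * (u 0 * v k 0 ^ 2 / 2 + u 1 * v k 0 * v k 1 / 2 - μ * v k 0) +
      e i 1 * (u 1 * v k 1 ^ 2 / 2 + u 0 * v k 0 * v k 1 / 2 - μ * v k 1) with hF
  rw [← sub_eq_zero.2 (hshift F), ← Finset.sum_sub_distrib]
  refine Finset.sum_congr rfl fun j _ => ?_
  simp only [hF, hw, dot2, rot90, he j, Pi.sub_apply, Matrix.cons_val_zero, Matrix.cons_val_one]
  ring
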